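/- Let P₁ ≤ P₂ be positive integers and let x > 0 be a real number with P₂·x ≤ 2. Then Ξ_{P₂}(x) ≤ Ξ_{P₁}(x). Consequently, the wideband loss factor γ(P) = (1 − Ξ_P(x))/3 is nondecreasing in P on the range of positive integers P with P·x ≤ 2. -/

import Mathlib

open Real Finset

/-- Dirichlet sinc function `Ξ_N(x) = (1/N) Σ_{p=0}^{N-1} cos(π (p - (N-1)/2) x)`. -/
noncomputable def dirichletSinc (N : ℕ) (x : ℝ) : ℝ :=
  (1 / (N : ℝ)) * ∑ p ∈ Finset.range N, Real.cos (Real.pi * ((p : ℝ) - ((N : ℝ) - 1) / 2) * x)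

theorem sin_mul_dirichletSinc (N : ℕ) (x : ℝ) :
    Real.sin (π * x / 2) * dirichletSinc N x = Real.sin (N * (π * x / 2)) / N := by
  have hsum : 2 * (Real.sin (π * x / 2) *
      ∑ p ∈ range N, Real.cos (π * ((p : ℝ) - ((N : ℝ) - 1) / 2) * x)) =
      2 * Real.sin (N * (π * x / 2)) := by
    have hterm : ∀ p ∈ range N,
        2 * (Real.sin (π * x / 2) * Real.cos (π * ((p : ℝ) - ((N : ℝ) - 1) / 2) * x)) =
        Real.sin ((2 * ((p + 1 : ℕ) : ℝ) - N) * (π * x / 2)) -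
          Real.sin ((2 * (p : ℝ) - N) * (π * x / 2)) := by
      intro p _
      have h₁ : (2 * ((p + 1 : ℕ) : ℝ) - N) * (π * x / 2) =
          π * ((p : ℝ) - ((N : ℝ) - 1) / 2) * x + π * x / 2 := by
        push_cast
        ring
      have h₂ : (2 * (p : ℝ) - N) * (π * x / 2) =
          π * ((p : ℝ) - ((N : ℝ) - 1) / 2) * x - π * x / 2 := by
        ring
      rw [h₁, h₂, Real.sin_add, Real.sin_sub]
      ring
    rw [mul_sum, mul_sum, sum_congr rfl hterm,
      sum_range_sub (fun p : ℕ => Real.sin ((2 * (p : ℝ) - N) * (π * x / 2)))]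
    have h₁ : (2 * (N : ℝ) - N) * (π * x / 2) = N * (π * x / 2) := by ring
    have h₂ : (2 * ((0 : ℕ) : ℝ) - N) * (π * x / 2) = -(N * (π * x / 2)) := by
      push_cast
      ring
    rw [h₁, h₂, Real.sin_neg]
    ring
  rw [dirichletSinc, mul_left_comm, mul_left_cancel₀ two_ne_zero hsum]
  ring

/-- By concavity of `sin` on `[0, π]`, the quotient `sin (t * a) / t` is antitone in `t`. -/
theorem sin_mul_div_le_sin_mul_div {s t a : ℝ} (hs : 0 < s) (hst : s ≤ t) (ha : 0 ≤ a)
    (hta : t * a ≤ π) : Real.sin (t * a) / t ≤ Real.sin (s * a) / s := by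
  have ht : 0 < t := hs.trans_le hst
  have h := strictConcaveOn_sin_Icc.concaveOn.2
    (⟨by positivity, hta⟩ : t * a ∈ Set.Icc 0 π) (⟨le_rfl, pi_pos.le⟩ : (0 : ℝ) ∈ Set.Icc 0 π)
    (by positivity : 0 ≤ s / t) (sub_nonneg.2 ((div_le_one ht).2 hst))
    (add_sub_cancel (s / t) 1)
  have hsa : s / t * (t * a) = s * a := by field_simp
  simp only [smul_eq_mul, Real.sin_zero, mul_zero, add_zero, hsa] at h
  rw [le_div_iff₀ hs]
  calc Real.sin (t * a) / t * s = s / t * Real.sin (t * a) := by ring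
    _ ≤ Real.sin (s * a) := h

/-- For fixed `x > 0` and `P·x ≤ 2`, the Dirichlet sinc value `Ξ_P(x)` is nonincreasing
in `P`; consequently the wideband loss factor `γ(P) = (1 - Ξ_P(x))/3` is nondecreasing
in `P` on this range. -/
theorem dirichletSinc_antitone_gamma_monotone
    (P₁ P₂ : ℕ) (hP₁ : 0 < P₁) (hP₁₂ : P₁ ≤ P₂) (x : ℝ) (hx : 0 < x)
    (hPx : (P₂ : ℝ) * x ≤ 2) :
    dirichletSinc P₂ x ≤ dirichletSinc P₁ x ∧
    (1 - dirichletSinc P₁ x) / 3 ≤ (1 - dirichletSinc P₂ x) / 3 := by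
  have key : dirichletSinc P₂ x ≤ dirichletSinc P₁ x := by
    rcases hP₁₂.eq_or_lt with rfl | hlt
    · exact le_rfl
    have hP₂ : (2 : ℝ) ≤ P₂ := by exact_mod_cast (by omega : 2 ≤ P₂)
    have hx1 : x ≤ 1 := by nlinarith
    have hsin : 0 < Real.sin (π * x / 2) :=
      Real.sin_pos_of_pos_of_lt_pi (by positivity) (by nlinarith [pi_pos])
    refine le_of_mul_le_mul_left ?_ hsin
    rw [sin_mul_dirichletSinc, sin_mul_dirichletSinc]
    exact sin_mul_div_le_sin_mul_div (by exact_mod_cast hP₁) (by exact_mod_cast hP₁₂)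
      (by positivity) (by nlinarith [pi_pos])
  exact ⟨key, by linarith⟩
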